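/- arXiv:2310.03355 — 2 statements merged into one kernel-verified Lean document; each statement's English description precedes it below -/
import Mathlib

section
/- Let m be a positive integer with prime factorization m = p_1^{e_1} p_2^{e_2} ⋯ p_ℓ^{e_ℓ}, where p_1, …, p_ℓ are ℓ ≥ 2 distinct primes. Then there exists a constant c > 0 (depending only on m) such that for every n ≥ 16 there exist a positive integer t with t ≤ exp(c · (log₂ n · (log₂ log₂ n)^{ℓ−1})^{1/ℓ}) and coefficients b'_{ij}, c'_{ij} ∈ ℤ/mℤ (for 1 ≤ i ≤ n, 1 ≤ j ≤ t) such that, writing the bilinear polynomial Σ_{j=1}^{t} (Σ_{i=1}^{n} b'_{ij} x_i)(Σ_{i=1}^{n} c'_{ij} y_i) over ℤ/mℤ in the form Σ_{i,j∈{1,…,n}} a_{ij} x_i y_j, the coefficients a_{ij} ∈ ℤ/mℤ satisfy: (i) a_{ii} = 0 in ℤ/mℤ for every i; (ii) a_{ij} = a_{ji} for all i ≠ j; (iii) for every i ≠ j and every k ∈ {1, …, ℓ}, a_{ij} ≡ 0 (mod p_k^{e_k}) or a_{ij} ≡ 1 (mod p_k^{e_k}); and (iv) for every i ≠ j there exists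 k ∈ {1, …, ℓ} with a_{ij} ≡ 1 (mod p_k^{e_k}). -/
/-- `A` is a sum of `t` products (a bilinear form with `t` terms). -/
def BRep {X R : Type} [CommRing R] (A : X → X → R) (t : ℕ) : Prop :=
  ∃ (ι : Type) (_ : Fintype ι) (b c : X → ι → R),
    Fintype.card ι = t ∧ ∀ x y, A x y = ∑ k, b x k * c y k

lemma BRep.one {X R : Type} [CommRing R] : BRep (fun _ _ : X => (1 : R)) 1 :=
  ⟨Unit, inferInstance, fun _ _ => 1, fun _ _ => 1, by simp, by simp⟩

lemma BRep.mul {X R : Type} [CommRing R] {A B : X → X → R} {s t : ℕ}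
    (hA : BRep A s) (hB : BRep B t) : BRep (fun x y => A x y * B x y) (s * t) := by
  obtain ⟨ι, _, b, c, h1, h2⟩ := hA
  obtain ⟨κ, _, b', c', h1', h2'⟩ := hB
  refine ⟨ι × κ, inferInstance, fun x k => b x k.1 * b' x k.2, fun x k => c x k.1 * c' x k.2,
    by simp [h1, h1'], fun x y => ?_⟩
  beta_reduce
  rw [h2, h2', Finset.sum_mul_sum, Fintype.sum_prod_type]
  refine Finset.sum_congr rfl fun i _ => Finset.sum_congr rfl fun j _ => by ring

lemma BRep.pow {X R : Type} [CommRing R] {A : X → X → R} {s : ℕ}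
    (hA : BRep A s) (k : ℕ) : BRep (fun x y => A x y ^ k) (s ^ k) := by
  induction k with
  | zero => simpa using BRep.one
  | succ k ih => simpa [pow_succ] using ih.mul hA

lemma BRep.smul {X R : Type} [CommRing R] {A : X → X → R} {s : ℕ}
    (hA : BRep A s) (u : R) : BRep (fun x y => u * A x y) s := by
  obtain ⟨ι, _, b, c, h1, h2⟩ := hA
  refine ⟨ι, inferInstance, fun x k => u * b x k, c, h1, fun x y => ?_⟩
  beta_reduce
  rw [h2, Finset.mul_sum]
  exact Finset.sum_congr rfl fun i _ => by ring

lemma BRep.add {X R : Type} [CommRing R] {A B : X → X → R} {s t : ℕ}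
    (hA : BRep A s) (hB : BRep B t) : BRep (fun x y => A x y + B x y) (s + t) := by
  obtain ⟨ι, _, b, c, h1, h2⟩ := hA
  obtain ⟨κ, _, b', c', h1', h2'⟩ := hB
  refine ⟨ι ⊕ κ, inferInstance, fun x => Sum.elim (b x) (b' x), fun x => Sum.elim (c x) (c' x),
    by simp [h1, h1'], fun x y => ?_⟩
  simp [h2, h2']

lemma BRep.sum {X R : Type} [CommRing R] {ℓ : ℕ} {A : Fin ℓ → X → X → R} {s : Fin ℓ → ℕ}
    (hA : ∀ k, BRep (A k) (s k)) : BRep (fun x y => ∑ k, A k x y) (∑ k, s k) := by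
  induction ℓ with
  | zero => exact ⟨Empty, inferInstance, fun _ _ => 0, fun _ _ => 0, by simp, by simp⟩
  | succ ℓ ih =>
    simp only [Fin.sum_univ_succ]
    exact (hA 0).add (ih fun k => hA k.succ)

lemma BRep.choose {X R α : Type} [CommRing R] [Fintype α] [DecidableEq α] (G : X → Finset α)
    (D : ℕ) : BRep (fun x y => (((G x ∩ G y).card.choose D : ℕ) : R))
      ((Fintype.card α).choose D) := by
  classical
  refine ⟨{S // S ∈ Finset.powersetCard D (Finset.univ : Finset α)}, inferInstance,
    fun x S => if S.1 ⊆ G x then 1 else 0, fun x S => if S.1 ⊆ G x then 1 else 0, ?_, ?_⟩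
  · simp [Finset.card_powersetCard]
  · intro x y
    rw [Finset.sum_coe_sort (Finset.powersetCard D (Finset.univ : Finset α))
      (fun S => (if S ⊆ G x then (1 : R) else 0) * (if S ⊆ G y then (1 : R) else 0))]
    beta_reduce
    rw [← Finset.card_powersetCard, Finset.cast_card]
    simp only [← ite_and, mul_ite, mul_one, mul_zero]
    rw [← Finset.sum_filter]
    refine Finset.sum_congr ?_ fun _ _ => rfl
    ext S
    simp only [Finset.mem_powersetCard, Finset.mem_filter, Finset.subset_inter_iff,
      Finset.subset_univ, true_and]
    tauto

lemma choose_pp (p : ℕ) (hp : p.Prime) (r v : ℕ) :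
    (p ^ r ∣ v + 1 → v.choose (p ^ r - 1) ≡ 1 [MOD p]) ∧
    (¬ p ^ r ∣ v + 1 → v.choose (p ^ r - 1) ≡ 0 [MOD p]) := by
  have := Fact.mk hp
  have hp0 := hp.pos
  induction r generalizing v with
  | zero => simp [Nat.ModEq.refl]
  | succ r ih =>
    have hpr : 0 < p ^ r := pow_pos hp0 r
    have e1 : p ^ (r + 1) - 1 = (p - 1) + p * (p ^ r - 1) := by
      rw [pow_succ, Nat.mul_sub, mul_comm p]
      have : p ≤ p ^ r * p := Nat.le_mul_of_pos_left _ hpr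
      omega
    have hm : (p ^ (r + 1) - 1) % p = p - 1 := by
      rw [e1, Nat.add_mul_mod_self_left, Nat.mod_eq_of_lt (by omega)]
    have hd : (p ^ (r + 1) - 1) / p = p ^ r - 1 := by
      rw [e1, Nat.add_mul_div_left _ _ hp0, Nat.div_eq_of_lt (by omega), zero_add]
    have key := Choose.choose_modEq_choose_mod_mul_choose_div_nat (p := p) (n := v)
      (k := p ^ (r + 1) - 1)
    rw [hm, hd] at key
    have hv := Nat.mod_add_div v p
    have hlt := Nat.mod_lt v hp0
    by_cases h : v % p = p - 1
    · rw [h, Nat.choose_self, one_mul] at key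
      have : v + 1 = p * (v / p + 1) := by rw [mul_add]; omega
      rw [this, pow_succ, mul_comm (p ^ r), Nat.mul_dvd_mul_iff_left hp0]
      rw [pow_succ, mul_comm (p ^ r)] at key
      exact ⟨fun h => key.trans ((ih _).1 h), fun h => key.trans ((ih _).2 h)⟩
    · rw [Nat.choose_eq_zero_of_lt (show v % p < p - 1 by omega), zero_mul] at key
      refine ⟨fun hh => ?_, fun _ => key⟩
      exfalso
      have h2 : p ∣ v + 1 := (dvd_pow_self p (by omega)).trans hh
      apply h
      obtain ⟨w, hw⟩ := h2
      have : (v % p + 1) = p * (w - v / p) := by rw [Nat.mul_sub]; omega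
      have : p ∣ v % p + 1 := ⟨_, this⟩
      have := Nat.le_of_dvd (by omega) this
      omega

lemma choose_ppe (p : ℕ) (hp : p.Prime) (e : ℕ) (he : 1 ≤ e) (r v : ℕ) :
    (p ^ r ∣ v + 1 → ((v.choose (p ^ r - 1) : ℕ) : ZMod (p ^ e)) ^ p ^ (e - 1) = 1) ∧
    (¬ p ^ r ∣ v + 1 → ((v.choose (p ^ r - 1) : ℕ) : ZMod (p ^ e)) ^ p ^ (e - 1) = 0) := by
  have gen : ∀ w b : ℕ, w ≡ b [MOD p] →
      ((w : ℕ) : ZMod (p ^ e)) ^ p ^ (e - 1) = (b : ZMod (p ^ e)) ^ p ^ (e - 1) := by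
    intro w b h
    have h1 : (p : ℤ) ∣ (w : ℤ) - b := by
      exact (Nat.modEq_iff_dvd.1 h.symm)
    have h2 := dvd_sub_pow_of_dvd_sub h1 (e - 1)
    rw [Nat.sub_add_cancel he] at h2
    have h3 := (ZMod.intCast_zmod_eq_zero_iff_dvd
      ((w : ℤ) ^ p ^ (e - 1) - (b : ℤ) ^ p ^ (e - 1)) (p ^ e)).2 (by exact_mod_cast h2)
    push_cast at h3
    exact sub_eq_zero.1 h3
  obtain ⟨h1, h2⟩ := choose_pp p hp r v
  refine ⟨fun h => ?_, fun h => ?_⟩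
  · rw [gen _ _ (h1 h)]; simp
  · rw [gen _ _ (h2 h)]; simp [hp.ne_zero]

lemma combin (m ℓ : ℕ) (p e : Fin ℓ → ℕ)
    (hℓ : 2 ≤ ℓ)
    (hp : ∀ i, (p i).Prime)
    (hinj : Function.Injective p)
    (he : ∀ i, 1 ≤ e i)
    (hm : m = ∏ i, p i ^ e i) (n N q M : ℕ) (hn : n ≤ q ^ N) (hM : 1 ≤ M) (hN : N < M ^ ℓ) :
    ∃ t : ℕ, 0 < t ∧ t ≤ ℓ * (1 + (N * q + m * M) ^ (m * M)) ∧
          ∃ b' c' : Fin n → Fin t → ZMod m,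
            ∃ a : Fin n → Fin n → ZMod m,
              (∀ i j, a i j = ∑ k, b' i k * c' j k) ∧
              (∀ i, a i i = 0) ∧
              (∀ i j, i ≠ j → a i j = a j i) ∧
              (∀ i j, i ≠ j → ∀ k : Fin ℓ,
                (((a i j).val : ZMod (p k ^ e k)) = 0 ∨
                 ((a i j).val : ZMod (p k ^ e k)) = 1)) ∧
              (∀ i j, i ≠ j → ∃ k : Fin ℓ,
                ((a i j).val : ZMod (p k ^ e k)) = 1) := by
  classical
  have hm0 : 0 < m := by
    rw [hm]; exact Finset.prod_pos fun i _ => pow_pos (hp i).pos _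
  have : NeZero m := ⟨hm0.ne'⟩
  have hdvd : ∀ k, p k ^ e k ∣ m := fun k => hm ▸ Finset.dvd_prod_of_mem _ (Finset.mem_univ k)
  have hle : ∀ k, p k ^ e k ≤ m := fun k => Nat.le_of_dvd hm0 (hdvd k)
  have hple : ∀ k, p k ≤ m := fun k =>
    (Nat.le_self_pow (by have := he k; omega) _).trans (hle k)
  -- words
  have hw : ∃ w : Fin n → (Fin N → Fin q), Function.Injective w := by
    have : Fintype.card (Fin n) ≤ Fintype.card (Fin N → Fin q) := by simpa using hn
    obtain ⟨f⟩ := Function.Embedding.nonempty_of_card_le this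
    exact ⟨f, f.injective⟩
  obtain ⟨w, hw⟩ := hw
  have hr : ∀ k, ∃ r, M ≤ p k ^ r ∧ p k ^ r ≤ p k * M := fun k =>
    ⟨Nat.log (p k) M + 1, (Nat.lt_pow_succ_log_self (hp k).one_lt M).le, by
      rw [pow_succ, mul_comm]
      exact Nat.mul_le_mul_left _ (Nat.pow_log_le_self _ (by omega))⟩
  choose r hr1 hr2 using hr
  have ha : ∀ k, ∃ a, a < p k ^ r k ∧ p k ^ r k ∣ N + a + 1 := fun k => by
    have h0 : 0 < p k ^ r k := pow_pos (hp k).pos _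
    have hlt := Nat.mod_lt N h0
    have hv := Nat.mod_add_div N (p k ^ r k)
    generalize p k ^ r k = P at *
    generalize N % P = z at *
    refine ⟨P - 1 - z, by omega, N / P + 1, ?_⟩
    rw [mul_add]; omega
  choose a ha1 ha2 using ha
  let G : ∀ k, Fin n → Finset ((Fin N × Fin q) ⊕ Fin (a k)) := fun k x =>
    (Finset.univ.image fun u => (u, w x u)).disjSum Finset.univ
  let s : Fin n → Fin n → ℕ := fun x y => (Finset.univ.filter fun u => w x u = w y u).card
  have hG : ∀ k x y, (G k x ∩ G k y).card = s x y + a k := by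
    intro k x y
    have : G k x ∩ G k y = ((Finset.univ.filter fun u => w x u = w y u).image
        fun u => (u, w x u)).disjSum Finset.univ := by
      ext z
      rcases z with ⟨u, z⟩ | z
      · simp [G]
        constructor
        · rintro ⟨h1, h2⟩; exact ⟨h1.trans h2.symm, h1⟩
        · rintro ⟨h1, h2⟩; exact ⟨h2, h1 ▸ h2⟩
      · simp [G]
    rw [this, Finset.card_disjSum, Finset.card_image_of_injective]
    · simp [s]
    · intro u v h; exact (Prod.ext_iff.1 h).1
  have hsN : ∀ x y, s x y ≤ N := fun x y => by
    simpa using Finset.card_le_univ (Finset.univ.filter fun u => w x u = w y u)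
  have hsdiag : ∀ x, s x x = N := fun x => by simp [s]
  have hsne : ∀ x y, x ≠ y → s x y < N := fun x y h => by
    refine lt_of_le_of_ne (hsN x y) fun h2 => h (hw ?_)
    have : (Finset.univ.filter fun u => w x u = w y u) = Finset.univ := by
      rw [← Finset.card_eq_iff_eq_univ]; simpa using h2
    funext u
    have hu := Finset.mem_univ u
    rw [← this] at hu
    simpa using hu
  have hssymm : ∀ x y, s x y = s y x := fun x y => by simp [s, eq_comm]
  have hdv : ∀ k x y, p k ^ r k ∣ s x y + a k + 1 ↔ p k ^ r k ∣ N - s x y := fun k x y => by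
    have : N + a k + 1 = (s x y + a k + 1) + (N - s x y) := by have := hsN x y; omega
    have h2 := ha2 k
    rw [this] at h2
    exact ⟨fun h => (Nat.dvd_add_iff_right h).2 h2, fun h => (Nat.dvd_add_iff_left h).2 h2⟩
  have hcop : Pairwise (Function.onFun Nat.Coprime fun k => p k ^ e k) := fun i j hij =>
    Nat.Coprime.pow _ _ ((Nat.coprime_primes (hp i) (hp j)).2 fun h => hij (hinj h))
  have hφ : ∃ φ : ZMod m ≃+* (∀ k, ZMod (p k ^ e k)), True := by
    subst hm
    exact ⟨ZMod.prodEquivPi _ hcop, trivial⟩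
  obtain ⟨φ, -⟩ := hφ
  let u : Fin ℓ → ZMod m := fun k => φ.symm (Pi.single k 1)
  let F : Fin ℓ → Fin n → Fin n → ZMod m := fun k x y =>
    ((((G k x ∩ G k y).card.choose (p k ^ r k - 1) : ℕ)) : ZMod m) ^ p k ^ (e k - 1)
  let A : Fin n → Fin n → ZMod m := fun x y => ∑ k, u k * (1 + (-1) * F k x y)
  let T : ℕ := ∑ k, (1 + ((N * q + a k).choose (p k ^ r k - 1)) ^ p k ^ (e k - 1))
  have hrep : BRep A T := by
    refine BRep.sum fun k => (BRep.one.add (BRep.smul ?_ _)).smul _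
    have := (BRep.choose (R := ZMod m) (G k) (p k ^ r k - 1)).pow (p k ^ (e k - 1))
    simpa using this
  have hφA : ∀ x y k, φ (A x y) k =
      1 - (((s x y + a k).choose (p k ^ r k - 1) : ℕ) : ZMod (p k ^ e k)) ^ p k ^ (e k - 1) := by
    intro x y k
    simp only [A, F, u, hG]
    simp only [map_sum, Finset.sum_apply, map_mul, Pi.mul_apply, RingEquiv.apply_symm_apply]
    rw [Finset.sum_eq_single k]
    · simp [sub_eq_add_neg]
    · intro j _ hj
      rw [Pi.single_eq_of_ne hj.symm, zero_mul]
    · simp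
  have hφ1 : ∀ x y k, p k ^ r k ∣ N - s x y → φ (A x y) k = 0 := fun x y k h => by
    rw [hφA, (choose_ppe _ (hp k) _ (he k) _ _).1 ((hdv k x y).2 h), sub_self]
  have hφ2 : ∀ x y k, ¬ p k ^ r k ∣ N - s x y → φ (A x y) k = 1 := fun x y k h => by
    rw [hφA, (choose_ppe _ (hp k) _ (he k) _ _).2 (fun h' => h ((hdv k x y).1 h')), sub_zero]
  have hval : ∀ (z : ZMod m) k, ((z.val : ℕ) : ZMod (p k ^ e k)) = φ z k := fun z k => by
    conv_rhs => rw [← ZMod.natCast_zmod_val z]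
    rw [map_natCast, Pi.natCast_apply]
  have hT0 : 0 < T := by
    refine Finset.sum_pos (fun k _ => by positivity) ⟨⟨0, by omega⟩, Finset.mem_univ _⟩
  have hTle : T ≤ ℓ * (1 + (N * q + m * M) ^ (m * M)) := by
    have hmM : 1 ≤ m * M := Nat.mul_pos hm0 hM
    calc T ≤ ∑ k : Fin ℓ, (1 + (N * q + m * M) ^ (m * M)) := by
          refine Finset.sum_le_sum fun k _ => Nat.add_le_add_left ?_ _
          have hak : a k ≤ m * M :=
            (ha1 k).le.trans ((hr2 k).trans (Nat.mul_le_mul_right _ (hple k)))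
          calc ((N * q + a k).choose (p k ^ r k - 1)) ^ p k ^ (e k - 1)
              ≤ ((N * q + a k) ^ (p k ^ r k - 1)) ^ p k ^ (e k - 1) :=
                Nat.pow_le_pow_left (Nat.choose_le_pow _ _) _
            _ ≤ ((N * q + m * M) ^ (p k ^ r k - 1)) ^ p k ^ (e k - 1) :=
                Nat.pow_le_pow_left (Nat.pow_le_pow_left (by omega) _) _
            _ = (N * q + m * M) ^ ((p k ^ r k - 1) * p k ^ (e k - 1)) := by rw [pow_mul]
            _ ≤ _ := by
              refine Nat.pow_le_pow_right (by omega) ?_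
              calc (p k ^ r k - 1) * p k ^ (e k - 1) ≤ (p k * M) * p k ^ (e k - 1) :=
                    Nat.mul_le_mul_right _ (by have := hr2 k; omega)
                _ = p k ^ (e k - 1 + 1) * M := by ring
                _ = p k ^ e k * M := by rw [Nat.sub_add_cancel (he k)]
                _ ≤ m * M := Nat.mul_le_mul_right _ (hle k)
      _ = _ := by simp
  obtain ⟨ι, _, b, c, hcard, hbc⟩ := hrep
  let E : Fin T ≃ ι := (Fintype.equivFinOfCardEq hcard).symm
  refine ⟨T, hT0, hTle, fun x k => b x (E k), fun x k => c x (E k), A, ?_, ?_, ?_, ?_, ?_⟩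
  · intro x y
    rw [hbc, ← E.sum_comp]
  · intro x
    apply φ.injective
    funext k
    rw [hφ1 x x k (by simp [hsdiag]), map_zero, Pi.zero_apply]
  · intro x y _
    apply φ.injective
    funext k
    rw [hφA, hφA, hssymm]
  · intro x y _ k
    rw [hval]
    by_cases h : p k ^ r k ∣ N - s x y
    · exact Or.inl (hφ1 _ _ _ h)
    · exact Or.inr (hφ2 _ _ _ h)
  · intro x y hxy
    by_contra! hcon
    have hall : ∀ k, p k ^ r k ∣ N - s x y := fun k => by
      by_contra h
      exact hcon k (by rw [hval]; exact hφ2 _ _ _ h)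
    have hprod : ∏ k, p k ^ r k ∣ N - s x y :=
      Finset.prod_dvd_of_isRelPrime (fun i _ j _ hij => by
        refine Nat.coprime_iff_isRelPrime.1 ?_
        exact Nat.Coprime.pow _ _ ((Nat.coprime_primes (hp i) (hp j)).2 fun h => hij (hinj h)))
        fun k _ => hall k
    have h1 := Nat.le_of_dvd (by have := hsne x y hxy; omega) hprod
    have h2 : M ^ ℓ ≤ ∏ k, p k ^ r k := by
      have := Finset.prod_le_prod' (s := Finset.univ) (fun k _ => hr1 k)
      simpa using this
    omega

lemma analytic (m ℓ : ℕ) (hℓ : 2 ≤ ℓ) (hm : 1 ≤ m) (n : ℕ) (hn : 16 ≤ n) :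
    ∃ N q M : ℕ, n ≤ q ^ N ∧ 1 ≤ M ∧ N < M ^ ℓ ∧
      ((ℓ * (1 + (N * q + m * M) ^ (m * M)) : ℕ) : ℝ) ≤
        Real.exp ((3 * m * (3 + m) + 2 * ℓ) * (Real.logb 2 n *
              (Real.logb 2 (Real.logb 2 n)) ^ (ℓ - 1)) ^ ((1 : ℝ) / ℓ)) := by
  set L := Real.logb 2 n with hLdef
  set lam := Real.logb 2 L with hlam
  have hn0 : (0 : ℝ) < n := by positivity
  have hL4 : 4 ≤ L := by
    rw [hLdef, Real.le_logb_iff_rpow_le (by norm_num) hn0]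
    norm_num; exact_mod_cast hn
  have hL0 : 0 < L := by linarith
  have hlam2 : 2 ≤ lam := by
    rw [hlam, Real.le_logb_iff_rpow_le (by norm_num) hL0]
    norm_num; exact hL4
  have hlam0 : 0 < lam := by linarith
  have h2L : (2 : ℝ) ^ L = n := Real.rpow_logb (by norm_num) (by norm_num) hn0
  have h2lam : (2 : ℝ) ^ lam = L := Real.rpow_logb (by norm_num) (by norm_num) hL0
  -- log L ≤ L / 2, i.e. L^2 ≤ 2^L
  have hlamL : lam ≤ L / 2 := by
    have h1 : Real.log (L / 4) ≤ L / 4 - 1 := Real.log_le_sub_one_of_pos (by positivity)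
    have h2 : Real.log (L / 4) = Real.log L - 2 * Real.log 2 := by
      rw [Real.log_div hL0.ne' (by norm_num), show (4 : ℝ) = 2 ^ 2 by norm_num, Real.log_pow]
      norm_num
    have h3 := Real.log_two_gt_d9
    rw [hlam, Real.logb, div_le_iff₀ (by linarith)]
    nlinarith
  set x := (L / lam) ^ ((1 : ℝ) / ℓ) with hx
  have hLl : 2 ≤ L / lam := by rw [le_div_iff₀ hlam0]; linarith
  have hℓ0 : (0 : ℝ) < ℓ := by positivity
  have hx1 : 1 ≤ x := Real.one_le_rpow (by linarith) (by positivity)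
  have hxℓ : x ^ ℓ = L / lam := by
    rw [hx, ← Real.rpow_natCast, ← Real.rpow_mul (by linarith), one_div,
      inv_mul_cancel₀ hℓ0.ne', Real.rpow_one]
  have hxL : x ≤ L := by
    have h1 : x ≤ x ^ ℓ := le_self_pow₀ hx1 (by omega)
    have h2 : L / lam ≤ L := div_le_self hL0.le (by linarith)
    linarith
  have hY : (L * lam ^ (ℓ - 1)) ^ ((1 : ℝ) / ℓ) = x * lam := by
    have : L * lam ^ (ℓ - 1) = (x * lam) ^ ℓ := by
      rw [mul_pow, hxℓ]
      obtain ⟨k, rfl⟩ : ∃ k, ℓ = k + 1 := ⟨ℓ - 1, by omega⟩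
      rw [Nat.add_sub_cancel, pow_succ]
      field_simp
    rw [this, one_div, Real.pow_rpow_inv_natCast (by positivity) (by omega)]
  rw [hY]
  refine ⟨⌈L / lam⌉₊, ⌈L⌉₊, ⌊2 * x⌋₊ + 1, ?_, by omega, ?_, ?_⟩
  · have h1 : (n : ℝ) ≤ (⌈L⌉₊ : ℝ) ^ (⌈L / lam⌉₊ : ℕ) := by
      calc (n : ℝ) = L ^ (L / lam) := by
            rw [← h2L]; nth_rewrite 2 [← h2lam]
            rw [← Real.rpow_mul (by norm_num), mul_div_cancel₀ _ hlam0.ne']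
        _ ≤ L ^ ((⌈L / lam⌉₊ : ℕ) : ℝ) :=
            Real.rpow_le_rpow_of_exponent_le (by linarith) (Nat.le_ceil _)
        _ = L ^ ⌈L / lam⌉₊ := Real.rpow_natCast _ _
        _ ≤ _ := pow_le_pow_left₀ hL0.le (Nat.le_ceil _) _
    exact_mod_cast h1
  · have h1 : ((⌈L / lam⌉₊ : ℕ) : ℝ) < ((⌊2 * x⌋₊ + 1 : ℕ) : ℝ) ^ ℓ := by
      have ha : ((⌈L / lam⌉₊ : ℕ) : ℝ) < L / lam + 1 := Nat.ceil_lt_add_one (by linarith)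
      have hb : 2 * x ≤ ((⌊2 * x⌋₊ + 1 : ℕ) : ℝ) := by
        push_cast; exact (Nat.lt_floor_add_one _).le
      have hc : (2 * x) ^ ℓ ≤ ((⌊2 * x⌋₊ + 1 : ℕ) : ℝ) ^ ℓ :=
        pow_le_pow_left₀ (by positivity) hb _
      have hd : (2 : ℝ) ≤ 2 ^ ℓ := le_self_pow₀ (by norm_num) (by omega)
      rw [mul_pow, hxℓ] at hc
      nlinarith
    exact_mod_cast h1
  · set N := ⌈L / lam⌉₊
    set q := ⌈L⌉₊
    set M := ⌊2 * x⌋₊ + 1 with hM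
    have hNL : (N : ℝ) ≤ L := by
      have h1 : (N : ℝ) < L / lam + 1 := Nat.ceil_lt_add_one (by linarith)
      have h2 : L / lam ≤ L / 2 := div_le_div_of_nonneg_left hL0.le (by norm_num) hlam2
      linarith
    have hqL : (q : ℝ) ≤ 2 * L := by
      have h1 : (q : ℝ) < L + 1 := Nat.ceil_lt_add_one hL0.le
      linarith
    have hMx : (M : ℝ) ≤ 3 * x := by
      have := Nat.floor_le (show 0 ≤ 2 * x by positivity)
      rw [hM]; push_cast; linarith
    have hm1 : (1 : ℝ) ≤ m := by exact_mod_cast hm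
    have hbase : ((N : ℝ) * q + m * M) ≤ (2 : ℝ) ^ ((3 + m) * lam) := by
      have e1 : (2 : ℝ) ^ ((3 + m) * lam) = L ^ 3 * L ^ m := by
        rw [mul_comm, Real.rpow_mul (by norm_num), h2lam, ← pow_add, ← Real.rpow_natCast]
        push_cast; rfl
      have e2 : (m : ℝ) ≤ L ^ m := by
        calc (m : ℝ) ≤ 2 ^ m := by exact_mod_cast Nat.lt_two_pow_self.le
          _ ≤ _ := pow_le_pow_left₀ (by norm_num) (by linarith) _
      have e3 : (N : ℝ) * q ≤ L * (2 * L) := mul_le_mul hNL hqL (by positivity) hL0.le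
      have e4 : (m : ℝ) * M ≤ m * (3 * L) :=
        mul_le_mul_of_nonneg_left (by linarith) (by positivity)
      rw [e1]
      calc (N : ℝ) * q + m * M ≤ 2 * L ^ 2 + 3 * m * L := by linarith
        _ ≤ m * L ^ 3 := by
          have f1 : 2 * L ^ 2 ≤ m * (2 * L ^ 2) := le_mul_of_one_le_left (by positivity) hm1
          have f2 : 2 * L ^ 2 + 3 * L ≤ L ^ 3 := by nlinarith [sq_nonneg L]
          nlinarith
        _ ≤ L ^ m * L ^ 3 := mul_le_mul_of_nonneg_right e2 (by positivity)
        _ = _ := by ring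
    have hpow : ((N : ℝ) * q + m * M) ^ (m * M) ≤ Real.exp (3 * m * (3 + m) * (x * lam)) := by
      calc ((N : ℝ) * q + m * M) ^ (m * M) ≤ ((2 : ℝ) ^ ((3 + m) * lam)) ^ (m * M) :=
            pow_le_pow_left₀ (by positivity) hbase _
        _ ≤ (Real.exp ((3 + m) * lam)) ^ (m * M) := by
            refine pow_le_pow_left₀ (by positivity) ?_ _
            rw [← Real.exp_one_rpow]
            refine Real.rpow_le_rpow (by norm_num) ?_ (by positivity)
            have := Real.add_one_le_exp (1 : ℝ); linarith
        _ = Real.exp ((m * M : ℕ) * ((3 + m) * lam)) := by rw [← Real.exp_nat_mul]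
        _ ≤ _ := by
            apply Real.exp_le_exp.2
            push_cast
            have : (m : ℝ) * ((3 + m) * lam) * M ≤ m * ((3 + m) * lam) * (3 * x) :=
              mul_le_mul_of_nonneg_left hMx (by positivity)
            nlinarith
    have hxl : 1 ≤ x * lam := by nlinarith
    set Y := x * lam
    have h1 : 1 ≤ Real.exp (3 * m * (3 + m) * Y) := Real.one_le_exp (by positivity)
    have h2 : 2 * (ℓ : ℝ) ≤ Real.exp (2 * ℓ * Y) := by
      have := Real.add_one_le_exp (2 * ℓ * Y)
      nlinarith
    rw [add_mul, Real.exp_add]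
    push_cast
    calc (ℓ : ℝ) * (1 + (N * q + m * M) ^ (m * M))
        ≤ ℓ * (2 * Real.exp (3 * m * (3 + m) * Y)) :=
          mul_le_mul_of_nonneg_left (by linarith) hℓ0.le
      _ = Real.exp (3 * m * (3 + m) * Y) * (2 * ℓ) := by ring
      _ ≤ _ := mul_le_mul_of_nonneg_left h2 (Real.exp_pos _).le

/-- 0-a-strong representation of the second elementary symmetric bilinear polynomial
`S_n^2(x,y) = Σ_{i≠j} x_i y_j` modulo `m = p_1^{e_1} ⋯ p_ℓ^{e_ℓ}` (ℓ ≥ 2 distinct primes)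
as a sum of `t = exp(O((log₂ n (log₂ log₂ n)^{ℓ-1})^{1/ℓ}))` products of linear forms.
The coefficient of `x_i y_j` in `Σ_j (Σ_i b'_{ij} x_i)(Σ_i c'_{ij} y_i)` is
`a i j = Σ_k b' i k * c' j k`; congruence of `a i j : ZMod m` modulo `p_k^{e_k}` is expressed
by reducing its canonical representative `(a i j).val` modulo `p_k^{e_k}`. -/
theorem zero_a_strong_representation_S2
    (m ℓ : ℕ) (p e : Fin ℓ → ℕ)
    (hℓ : 2 ≤ ℓ)
    (hp : ∀ i, (p i).Prime)
    (hinj : Function.Injective p)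
    (he : ∀ i, 1 ≤ e i)
    (hm : m = ∏ i, p i ^ e i) :
    ∃ c : ℝ, 0 < c ∧
      ∀ n : ℕ, 16 ≤ n →
        ∃ t : ℕ, 0 < t ∧
          (t : ℝ) ≤ Real.exp (c * (Real.logb 2 n *
              (Real.logb 2 (Real.logb 2 n)) ^ (ℓ - 1)) ^ ((1 : ℝ) / ℓ)) ∧
          ∃ b' c' : Fin n → Fin t → ZMod m,
            ∃ a : Fin n → Fin n → ZMod m,
              (∀ i j, a i j = ∑ k, b' i k * c' j k) ∧
              (∀ i, a i i = 0) ∧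
              (∀ i j, i ≠ j → a i j = a j i) ∧
              (∀ i j, i ≠ j → ∀ k : Fin ℓ,
                (((a i j).val : ZMod (p k ^ e k)) = 0 ∨
                 ((a i j).val : ZMod (p k ^ e k)) = 1)) ∧
              (∀ i j, i ≠ j → ∃ k : Fin ℓ,
                ((a i j).val : ZMod (p k ^ e k)) = 1) := by
  have hm1 : 1 ≤ m := by
    rw [hm]; exact Finset.prod_pos fun i _ => pow_pos (hp i).pos _
  refine ⟨3 * m * (3 + m) + 2 * ℓ, by positivity, fun n hn => ?_⟩
  obtain ⟨N, q, M, h1, h2, h3, h4⟩ := analytic m ℓ hℓ hm1 n hn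
  obtain ⟨t, ht0, htle, h⟩ := combin m ℓ p e hℓ hp hinj he hm n N q M h1 h2 h3
  exact ⟨t, ht0, le_trans (by exact_mod_cast htle) h4, h⟩
end

section
/- Let m be a positive integer with prime factorization m = p_1^{e_1} p_2^{e_2} ⋯ p_ℓ^{e_ℓ}, where p_1, …, p_ℓ are ℓ ≥ 2 distinct primes. Then there exists a constant c > 0 (depending only on m) such that for every n ≥ 16 there exist a positive integer s with s ≤ exp(c · (log₂ n · (log₂ log₂ n)^{ℓ−1})^{1/ℓ}) and integer coefficients b_{ij}, c_{ij} (for 1 ≤ i ≤ n, 1 ≤ j ≤ s) such that the bilinear polynomial g(x,y) = Σ_{j=1}^{s} (Σ_{i=1}^{n} b_{ij} x_i)(Σ_{i=1}^{n} c_{ij} y_i) satisfies: (i) for every i ∈ {1, …, n}, the coefficient of x_i y_i in g is congruent to 1 modulo m; and (ii) for all i ≠ j, the coefficient of x_i y_j in g is congruent to 0 modulo p_k^{e_k} for at least one k ∈ {1, …, ℓ}. -/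
lemma aux_dvd_choose (p f w : ℕ) (hp : p.Prime) (h : ¬ p ^ f ∣ w + 1) :
    p ∣ w.choose (p ^ f - 1) := by
  by_contra hc
  apply h
  have h1 := Nat.add_one_mul_choose_eq w (p ^ f - 1)
  have h2 : p ^ f - 1 + 1 = p ^ f := Nat.sub_add_cancel (Nat.pos_of_ne_zero (pow_ne_zero _ hp.ne_zero))
  rw [h2] at h1
  have h3 : p ^ f ∣ (w + 1) * w.choose (p ^ f - 1) := ⟨_, by rw [h1]; ring⟩
  have h4 : Nat.Coprime (p ^ f) (w.choose (p ^ f - 1)) :=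
    Nat.Coprime.pow_left _ ((Nat.Prime.coprime_iff_not_dvd hp).2 hc)
  exact h4.dvd_of_dvd_mul_right h3

lemma aux_choose_mod (p : ℕ) (hp : p.Prime) (f : ℕ) : ∀ t : ℕ, 0 < t →
    (p ^ f * t - 1).choose (p ^ f - 1) ≡ 1 [MOD p] := by
  have := Fact.mk hp
  induction f with
  | zero => intro t ht; simp; rfl
  | succ f ih =>
    intro t ht
    have key : ∀ a : ℕ, 0 < a → (p * a - 1) % p = p - 1 ∧ (p * a - 1) / p = a - 1 := by
      intro a ha
      obtain ⟨a, rfl⟩ := Nat.exists_eq_succ_of_ne_zero ha.ne'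
      have hp0 := hp.pos
      have : p * a.succ - 1 = (p - 1) + p * a := by
        rw [Nat.mul_succ]; omega
      rw [this]
      constructor
      · rw [Nat.add_mul_mod_self_left, Nat.mod_eq_of_lt (by omega)]
      · rw [Nat.add_mul_div_left _ _ hp0, Nat.div_eq_of_lt (by omega)]; simp
    have hpf : 0 < p ^ f := pow_pos hp.pos f
    have h := Choose.choose_modEq_choose_mod_mul_choose_div_nat (p := p)
      (n := p ^ (f+1) * t - 1) (k := p ^ (f+1) - 1)
    rw [pow_succ', mul_assoc] at h ⊢
    obtain ⟨h1, h2⟩ := key (p ^ f * t) (by positivity)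
    obtain ⟨h3, h4⟩ := key (p ^ f) hpf
    rw [h1, h2, h3, h4, Nat.choose_self, one_mul] at h
    exact h.trans (ih t ht)

/-- The combinatorial construction. -/
lemma aux_construct (m ℓ : ℕ) (p e f : Fin ℓ → ℕ)
    (hp : ∀ i, (p i).Prime) (hinj : Function.Injective p)
    (hm : m = ∏ i, p i ^ e i) (N h n : ℕ)
    (hN : N + 1 = ∏ i, p i ^ f i) (hn : n ≤ h.choose N) :
    ∃ s : ℕ, s = ∑ k, (h.choose (p k ^ f k - 1)) ^ (e k * (p k ^ e k).totient) ∧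
      ∃ b c' : Fin n → Fin s → ℤ, ∃ a : Fin n → Fin n → ℤ,
              (∀ i j, a i j = ∑ k, b i k * c' j k) ∧
              (∀ i, (m : ℤ) ∣ (a i i - 1)) ∧
              (∀ i j, i ≠ j → ∃ k : Fin ℓ, ((p k : ℤ) ^ (e k)) ∣ a i j) := by
  classical
  have hcop : ∀ i j, i ≠ j → ∀ x y, Nat.Coprime (p i ^ x) (p j ^ y) := fun i j hij x y =>
    Nat.Coprime.pow _ _ ((Nat.coprime_primes (hp i) (hp j)).2 (fun h => hij (hinj h)))
  obtain ⟨S, hSinj, hS⟩ : ∃ S : Fin n → Finset (Fin h), Function.Injective S ∧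
      ∀ i, (S i).card = N := by
    have : Fintype.card (Fin n) ≤ Fintype.card {R : Finset (Fin h) // R.card = N} := by
      simpa using hn
    obtain ⟨φ⟩ := Function.Embedding.nonempty_of_card_le this
    exact ⟨fun i => (φ i).1, fun i j hij => φ.injective (Subtype.ext hij), fun i => (φ i).2⟩
  let E : Fin ℓ → ℕ := fun k => e k * (p k ^ e k).totient
  let r : Fin ℓ → ℕ := fun k => p k ^ f k - 1
  let θ : Fin ℓ → ℤ := fun k => ((∏ j ∈ Finset.univ.erase k, p j ^ e j) ^ (p k ^ e k).totient : ℕ)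
  have hθ1 : ∀ k, ((p k : ℤ) ^ e k) ∣ θ k - 1 := by
    intro k
    have h1 : Nat.Coprime (∏ j ∈ Finset.univ.erase k, p j ^ e j) (p k ^ e k) :=
      Nat.Coprime.prod_left (fun j hj => hcop _ _ (Finset.ne_of_mem_erase hj) _ _)
    have := (Nat.ModEq.pow_totient h1).symm
    have := (Nat.modEq_iff_dvd.1 this)
    simpa [θ] using this
  have hθ0 : ∀ k j, j ≠ k → ((p j : ℤ) ^ e j) ∣ θ k := by
    intro k j hjk
    have h1 : p j ^ e j ∣ ∏ j ∈ Finset.univ.erase k, p j ^ e j :=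
      Finset.dvd_prod_of_mem _ (Finset.mem_erase.2 ⟨hjk, Finset.mem_univ _⟩)
    have h2 : (p k ^ e k).totient ≠ 0 :=
      (Nat.totient_pos.2 (pow_pos (hp k).pos _)).ne'
    have := Int.natCast_dvd_natCast.2 (h1.trans (dvd_pow_self _ h2))
    simpa [θ] using this
  let ι := Σ k : Fin ℓ, (Fin (E k) → {R : Finset (Fin h) // R.card = r k})
  have hcard : Fintype.card ι = ∑ k, (h.choose (p k ^ f k - 1)) ^ (e k * (p k ^ e k).totient) := by
    simp [ι, E, r]
  refine ⟨_, rfl, ?_⟩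
  rw [← hcard]
  let eq := (Fintype.equivFin ι).symm
  let ind : Fin n → ι → ℤ := fun i x => ∏ t, if (x.2 t).1 ⊆ S i then 1 else 0
  let a : Fin n → Fin n → ℤ := fun i j =>
    ∑ k, θ k * (((S i ∩ S j).card.choose (r k) : ℕ) : ℤ) ^ E k
  have ha : ∀ i j, a i j = ∑ x : ι, (θ x.1 * ind i x) * ind j x := by
    intro i j
    rw [Fintype.sum_sigma]
    refine Finset.sum_congr rfl fun k _ => ?_
    have h1 : (((S i ∩ S j).card.choose (r k) : ℕ) : ℤ) =
        ∑ R : {R : Finset (Fin h) // R.card = r k},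
          (if R.1 ⊆ S i then 1 else 0) * (if R.1 ⊆ S j then 1 else 0) := by
      have h2 : ∀ R : {R : Finset (Fin h) // R.card = r k},
          ((if R.1 ⊆ S i then 1 else 0) * (if R.1 ⊆ S j then 1 else 0) : ℤ)
           = if R.1 ⊆ S i ∩ S j then 1 else 0 := by
        intro R
        simp only [Finset.subset_inter_iff]
        by_cases h1 : R.1 ⊆ S i <;> by_cases h2 : R.1 ⊆ S j <;> simp [h1, h2]
      rw [Finset.sum_congr rfl (fun R _ => h2 R)]
      rw [← Finset.sum_subtype (Finset.powersetCard (r k) Finset.univ)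
        (by simp) (fun R => if R ⊆ S i ∩ S j then (1:ℤ) else 0)]
      rw [Finset.sum_ite, Finset.sum_const_zero, add_zero, Finset.sum_const,
        nsmul_eq_mul, mul_one, ← Finset.card_powersetCard]
      congr 2
      ext R
      simp [Finset.mem_powersetCard, and_comm]
    rw [h1, Fintype.sum_pow, Finset.mul_sum]
    refine Finset.sum_congr rfl fun x _ => ?_
    rw [Finset.prod_mul_distrib, mul_assoc]
  have hak : ∀ i j k, ((p k : ℤ) ^ e k) ∣
      a i j - (((S i ∩ S j).card.choose (r k) : ℕ) : ℤ) ^ E k := by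
    intro i j k
    have h1 : a i j - (((S i ∩ S j).card.choose (r k) : ℕ) : ℤ) ^ E k =
      (θ k - 1) * (((S i ∩ S j).card.choose (r k) : ℕ) : ℤ) ^ E k +
      ∑ k' ∈ Finset.univ.erase k, θ k' * (((S i ∩ S j).card.choose (r k') : ℕ) : ℤ) ^ E k' := by
      have := Finset.add_sum_erase Finset.univ
        (fun k => θ k * (((S i ∩ S j).card.choose (r k) : ℕ) : ℤ) ^ E k) (Finset.mem_univ k)
      simp only [a]
      rw [← this]; ring
    rw [h1]
    refine dvd_add (Dvd.dvd.mul_right (hθ1 k) _) (Finset.dvd_sum fun k' hk' => ?_)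
    exact Dvd.dvd.mul_right (hθ0 _ _ (Finset.ne_of_mem_erase hk').symm) _
  refine ⟨fun i x => θ (eq x).1 * ind i (eq x), fun j x => ind j (eq x), a, ?_, ?_, ?_⟩
  · intro i j
    rw [ha]
    exact (Equiv.sum_comp eq (fun x => (θ x.1 * ind i x) * ind j x)).symm
  · intro i
    have h0 : ∀ k, ((p k : ℤ) ^ e k) ∣ a i i - 1 := by
      intro k
      have h1 := hak i i k
      rw [Finset.inter_self, hS] at h1
      have h2 : N.choose (r k) ≡ 1 [MOD p k] := by
        have h3 : N = p k ^ f k * (∏ j ∈ Finset.univ.erase k, p j ^ f j) - 1 := by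
          rw [Finset.mul_prod_erase Finset.univ (fun j => p j ^ f j) (Finset.mem_univ k), ← hN]
          simp
        rw [h3]
        exact aux_choose_mod (p k) (hp k) (f k) _
          (Finset.prod_pos fun j _ => pow_pos (hp j).pos _)
      have h4 : Nat.Coprime (N.choose (r k)) (p k ^ e k) := by
        apply Nat.Coprime.pow_right
        have := h2.gcd_eq
        simpa [Nat.Coprime] using this
      have h5 : (N.choose (r k)) ^ E k ≡ 1 [MOD p k ^ e k] := by
        have := (Nat.ModEq.pow_totient h4).pow (e k)
        rw [← pow_mul, one_pow, mul_comm] at this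
        exact this
      have h6 := Nat.modEq_iff_dvd.1 h5.symm
      push_cast at h6
      have := dvd_add h1 h6
      simpa using this
    rw [hm]
    push_cast
    refine Fintype.prod_dvd_of_coprime ?_ h0
    intro x y hxy
    have := Nat.isCoprime_iff_coprime.2 (hcop x y hxy (e x) (e y))
    simpa using this
  · intro i j hij
    have hlt : (S i ∩ S j).card < N := by
      rw [← hS i]
      apply Finset.card_lt_card
      refine Finset.ssubset_iff_subset_ne.2 ⟨Finset.inter_subset_left, fun h => ?_⟩
      have h1 : S i ⊆ S j := Finset.inter_eq_left.1 h
      exact hij (hSinj (Finset.eq_of_subset_of_card_le h1 (by rw [hS, hS])))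
    obtain ⟨k, hk⟩ : ∃ k, ¬ p k ^ f k ∣ (S i ∩ S j).card + 1 := by
      by_contra hc
      push Not at hc
      have : (∏ k, p k ^ f k) ∣ (S i ∩ S j).card + 1 :=
        Fintype.prod_dvd_of_isRelPrime
          (fun x y hxy => Nat.coprime_iff_isRelPrime.1 (hcop x y hxy _ _)) hc
      have := Nat.le_of_dvd (by omega) this
      omega
    refine ⟨k, ?_⟩
    have h1 := aux_dvd_choose (p k) (f k) _ (hp k) hk
    have h2 : (p k : ℤ) ^ e k ∣ (((S i ∩ S j).card.choose (r k) : ℕ) : ℤ) ^ E k := by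
      have h2 : (p k : ℤ) ∣ (((S i ∩ S j).card.choose (r k) : ℕ) : ℤ) :=
        Int.natCast_dvd_natCast.2 h1
      refine (pow_dvd_pow_of_dvd h2 _).trans (pow_dvd_pow _ ?_)
      exact Nat.le_mul_of_pos_right _ (Nat.totient_pos.2 (pow_pos (hp k).pos _))
    have := dvd_add (hak i j k) h2
    simpa using this

lemma aux_choose_lower (N n : ℕ) (hn : n ≤ N ^ N) : n ≤ ((N + 1) ^ 2).choose N := by
  refine hn.trans ?_
  have h1 : ((((N + 1) ^ 2 + 1 - N : ℕ) : ℕ)) ^ N ≤ N.factorial * ((N + 1) ^ 2).choose N := by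
    have := Nat.pow_sub_le_descFactorial ((N + 1) ^ 2) N
    rwa [Nat.descFactorial_eq_factorial_mul_choose] at this
  have h2 : N * N ≤ (N + 1) ^ 2 + 1 - N := by
    have : N * N + N ≤ (N+1)^2 + 1 := by nlinarith
    omega
  have h3 : N ^ N * N ^ N ≤ N ^ N * ((N + 1) ^ 2).choose N := by
    rw [← mul_pow]
    exact (Nat.pow_le_pow_left h2 N).trans (h1.trans (Nat.mul_le_mul_right _ (Nat.factorial_le_pow N)))
  rcases Nat.eq_zero_or_pos N with rfl | hN
  · simp
  · exact Nat.le_of_mul_le_mul_left h3 (pow_pos hN N)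

lemma aux_log_bounds (n : ℕ) (hn : 16 ≤ n) :
    4 ≤ Real.logb 2 n ∧ 2 ≤ Real.logb 2 (Real.logb 2 n) ∧
    Real.logb 2 (Real.logb 2 n) ≤ 2 * √ (Real.logb 2 n) := by
  have h1 : 4 ≤ Real.logb 2 n := by
    rw [Real.le_logb_iff_rpow_le (by norm_num) (by positivity)]
    have : (16 : ℝ) ≤ n := by exact_mod_cast hn
    norm_num
    linarith
  refine ⟨h1, ?_, ?_⟩
  · rw [Real.le_logb_iff_rpow_le (by norm_num) (by linarith)]
    norm_num
    linarith
  · set L := Real.logb 2 n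
    have hs : 0 < √ L := Real.sqrt_pos.2 (by linarith)
    have h2 : Real.logb 2 L = 2 * Real.logb 2 (√ L) := by
      have hs' : √ L * √ L = L := Real.mul_self_sqrt (by linarith)
      nth_rewrite 1 [← hs']
      rw [Real.logb_mul hs.ne' hs.ne']; ring
    rw [h2]
    have h3 : Real.logb 2 (√ L) ≤ √ L := by
      rw [Real.logb_le_iff_le_rpow (by norm_num) hs]
      have := one_add_mul_self_le_rpow_one_add (s := 1) (by norm_num) (p := √ L) (by
        rw [Real.one_le_sqrt]; linarith)
      norm_num at this
      linarith
    linarith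

lemma aux_pow_lower (N n : ℕ) (hn : 16 ≤ n)
    (hN : 2 * Real.logb 2 n / Real.logb 2 (Real.logb 2 n) ≤ N) : n ≤ N ^ N := by
  obtain ⟨h1, h2, h3⟩ := aux_log_bounds n hn
  set L := Real.logb 2 n with hL
  set M := Real.logb 2 L with hM
  have hs : √ L * √ L = L := Real.mul_self_sqrt (by linarith)
  have hs0 : 0 < √ L := Real.sqrt_pos.2 (by linarith)
  rw [div_le_iff₀ (by linarith)] at hN
  have hNs : √ L ≤ N := by
    have : 2 * √ L * √ L ≤ N * (2 * √ L) := by nlinarith [(Nat.cast_nonneg N : (0:ℝ) ≤ N)]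
    nlinarith
  have hN0 : (0:ℝ) < N := by linarith
  have hlN : M / 2 ≤ Real.logb 2 N := by
    have h4 : Real.logb 2 (√ L) ≤ Real.logb 2 N :=
      Real.logb_le_logb_of_le (by norm_num) hs0 hNs
    have h5 : M = 2 * Real.logb 2 (√ L) := by
      rw [hM]; nth_rewrite 1 [← hs]
      rw [Real.logb_mul hs0.ne' hs0.ne']; ring
    linarith
  have h6 : L ≤ Real.logb 2 ((N:ℝ) ^ N) := by
    rw [Real.logb_pow]
    nlinarith
  have h7 : (n : ℝ) ≤ (N:ℝ) ^ N := by
    rwa [hL, Real.logb_le_logb (by norm_num) (by positivity) (by positivity)] at h6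
  exact_mod_cast h7

/-- 1-a-strong representation of the dot product `Σ_i x_i y_i` modulo
`m = p_1^{e_1} ⋯ p_ℓ^{e_ℓ}` (ℓ ≥ 2 distinct primes) as a sum of
`s = exp(O((log₂ n (log₂ log₂ n)^{ℓ-1})^{1/ℓ}))` products of integer linear forms:
the coefficient of `x_i y_j` in `g = Σ_j (Σ_i b_{ij} x_i)(Σ_i c_{ij} y_i)` is
`a i j = Σ_k b i k * c j k`; each diagonal coefficient is `≡ 1 (mod m)` and each
off-diagonal coefficient vanishes modulo some `p_k^{e_k}`. -/
theorem one_a_strong_representation_dot_product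
    (m ℓ : ℕ) (p e : Fin ℓ → ℕ)
    (hℓ : 2 ≤ ℓ)
    (hp : ∀ i, (p i).Prime)
    (hinj : Function.Injective p)
    (he : ∀ i, 1 ≤ e i)
    (hm : m = ∏ i, p i ^ e i) :
    ∃ c : ℝ, 0 < c ∧
      ∀ n : ℕ, 16 ≤ n →
        ∃ s : ℕ, 0 < s ∧
          (s : ℝ) ≤ Real.exp (c * (Real.logb 2 n *
              (Real.logb 2 (Real.logb 2 n)) ^ (ℓ - 1)) ^ ((1 : ℝ) / ℓ)) ∧
          ∃ b c' : Fin n → Fin s → ℤ,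
            ∃ a : Fin n → Fin n → ℤ,
              (∀ i j, a i j = ∑ k, b i k * c' j k) ∧
              (∀ i, (m : ℤ) ∣ (a i i - 1)) ∧
              (∀ i j, i ≠ j → ∃ k : Fin ℓ, ((p k : ℤ) ^ (e k)) ∣ a i j) := by
  let E : Fin ℓ → ℕ := fun k => e k * (p k ^ e k).totient
  let B : ℝ := ∑ k, (p k : ℝ) * E k
  let P : ℝ := ∏ k, (p k : ℝ)
  have hB : 0 ≤ B := Finset.sum_nonneg fun k _ => by positivity
  have hP : 1 ≤ P := by
    have : 1 ≤ ∏ k, p k := Finset.one_le_prod' fun k _ => (hp k).one_le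
    have h : ((1:ℕ):ℝ) ≤ ((∏ k, p k : ℕ) : ℝ) := by exact_mod_cast this
    simpa [P] using h
  have hℓ0 : (2:ℝ) ≤ ℓ := by exact_mod_cast hℓ
  refine ⟨4 * (ℓ + 2 * B * (4 * P + 1)), by positivity, fun n hn => ?_⟩
  obtain ⟨h1, h2, h3⟩ := aux_log_bounds n hn
  set L := Real.logb 2 n with hL
  set M := Real.logb 2 L with hM
  have hs : √ L * √ L = L := Real.mul_self_sqrt (by linarith)
  have hs2 : 2 ≤ √ L := by
    apply Real.le_sqrt_of_sq_le; linarith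
  have hML : M ≤ L := by nlinarith
  have hLM : 1 ≤ L / M := by rw [le_div_iff₀ (by linarith)]; linarith
  let X : ℝ := (4 * (L / M)) ^ ((1:ℝ) / ℓ)
  have hX1 : 1 ≤ X := Real.one_le_rpow (by linarith) (by positivity)
  have hXpow : X ^ ℓ = 4 * (L / M) := by
    simp only [X]
    rw [← Real.rpow_natCast, ← Real.rpow_mul (by linarith), one_div_mul_cancel (by positivity),
      Real.rpow_one]
  have hex : ∀ k, ∃ f : ℕ, X ≤ (p k : ℝ) ^ f ∧ (p k : ℝ) ^ f ≤ p k * X := by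
    intro k
    have hpk : (1:ℝ) < p k := by exact_mod_cast (hp k).one_lt
    obtain ⟨f, hf1, hf2⟩ := exists_nat_pow_near hX1 hpk
    refine ⟨f + 1, hf2.le, ?_⟩
    rw [pow_succ']
    gcongr
  choose f hf1 hf2 using hex
  let Q : ℕ := ∏ k, p k ^ f k
  have hQpos : 0 < Q := Finset.prod_pos fun j _ => pow_pos (hp j).pos _
  have hQ1 : 4 * (L / M) ≤ Q := by
    have : ∏ _k : Fin ℓ, X ≤ ∏ k, (p k : ℝ) ^ f k :=
      Finset.prod_le_prod (fun _ _ => by linarith) (fun k _ => hf1 k)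
    simp only [Finset.prod_const, Finset.card_univ, Fintype.card_fin, hXpow] at this
    simpa [Q] using this
  have hQ2 : (Q:ℝ) ≤ 4 * P * L := by
    have h4 : ∏ k, (p k : ℝ) ^ f k ≤ ∏ k : Fin ℓ, ((p k : ℝ) * X) :=
      Finset.prod_le_prod (fun _ _ => by positivity) (fun k _ => hf2 k)
    rw [Finset.prod_mul_distrib] at h4
    simp only [Finset.prod_const, Finset.card_univ, Fintype.card_fin, hXpow] at h4
    have h5 : L / M ≤ L := div_le_self (by linarith) (by linarith)
    have h6 : (Q:ℝ) ≤ P * (4 * (L / M)) := by simpa [Q] using h4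
    nlinarith
  obtain ⟨N, hN⟩ : ∃ N, N + 1 = Q := ⟨Q - 1, by omega⟩
  have hNQ : (N:ℝ) + 1 = Q := by exact_mod_cast hN
  have hnN : n ≤ ((N + 1) ^ 2).choose N := by
    apply aux_choose_lower
    apply aux_pow_lower N n hn
    rw [mul_div_assoc]
    linarith
  obtain ⟨s, hs, b, c', a, hab, hdiag, hoff⟩ :=
    aux_construct m ℓ p e f hp hinj hm N ((N+1)^2) n hN hnN
  refine ⟨s, ?_, ?_, b, c', a, hab, hdiag, hoff⟩
  · rcases Nat.eq_zero_or_pos s with h0 | h0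
    · exfalso
      subst h0
      have := hdiag ⟨0, by omega⟩
      rw [hab] at this
      simp only [Finset.univ_eq_empty, Finset.sum_empty, zero_sub, dvd_neg] at this
      have h5 : m ∣ 1 := by exact_mod_cast this
      have h6 : p ⟨0, by omega⟩ ∣ m := by
        rw [hm]
        exact (dvd_pow_self _ (by have := he ⟨0, by omega⟩; omega)).trans
          (Finset.dvd_prod_of_mem (fun i => p i ^ e i) (Finset.mem_univ _))
      exact (hp _).one_lt.ne' (Nat.dvd_one.1 (h6.trans h5))
    · exact h0
  · have hX0 : 0 < X := by linarith
    have hlogL : Real.log L ≤ M := by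
      rw [hM, Real.logb, le_div_iff₀ (Real.log_pos (by norm_num))]
      have := Real.log_two_lt_d9
      have h7 : 0 ≤ Real.log L := Real.log_nonneg (by linarith)
      nlinarith
    have hlogQ0 : 0 ≤ Real.log Q := Real.log_nonneg (by exact_mod_cast hQpos)
    have hlogQ : Real.log Q ≤ (4 * P + 1) * M := by
      have h8 : Real.log Q ≤ Real.log (4 * P * L) :=
        Real.log_le_log (by exact_mod_cast hQpos) hQ2
      rw [Real.log_mul (by positivity) (by linarith)] at h8
      have h9 : Real.log (4 * P) ≤ 4 * P := Real.log_le_self (by positivity)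
      nlinarith
    have hterm : ∀ k, ((((N+1)^2).choose (p k ^ f k - 1)) ^ (e k * (p k ^ e k).totient) : ℝ)
        ≤ Real.exp (2 * B * (4 * P + 1) * (X * M)) := by
      intro k
      have h10 : ((((N+1)^2).choose (p k ^ f k - 1)) ^ (E k)) ≤ Q ^ (2 * (p k ^ f k) * E k) := by
        rw [hN, pow_mul Q]
        apply Nat.pow_le_pow_left
        refine (Nat.choose_le_pow _ _).trans ?_
        rw [← pow_mul]
        exact Nat.pow_le_pow_right hQpos (by gcongr; omega)
      have h11 : ((((N+1)^2).choose (p k ^ f k - 1)) ^ (E k) : ℝ) ≤ (Q:ℝ) ^ (2 * (p k ^ f k) * E k) := by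
        exact_mod_cast h10
      refine h11.trans ?_
      rw [← Real.exp_log (show (0:ℝ) < Q by exact_mod_cast hQpos), ← Real.exp_nat_mul,
        Real.exp_le_exp]
      push_cast
      have h12 : (p k : ℝ) * E k ≤ B :=
        Finset.single_le_sum (f := fun k => (p k : ℝ) * E k) (fun i _ => by positivity)
          (Finset.mem_univ k)
      calc 2 * (p k : ℝ) ^ f k * E k * Real.log Q
          ≤ 2 * (p k * X) * E k * ((4 * P + 1) * M) := by gcongr; exact hf2 k
        _ = 2 * ((p k * E k) * (X * ((4 * P + 1) * M))) := by ring
        _ ≤ 2 * (B * (X * ((4 * P + 1) * M))) := by gcongr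
        _ = _ := by ring
    have hXM : X * M ≤ 4 * (L * M ^ (ℓ - 1)) ^ ((1:ℝ) / ℓ) := by
      have hM0 : 0 ≤ M := by linarith
      have h13 : X * M = (4 * (L * M ^ (ℓ - 1))) ^ ((1:ℝ) / ℓ) := by
        have h14 : M = (M ^ ℓ) ^ ((1:ℝ) / ℓ) := by
          rw [← Real.rpow_natCast, ← Real.rpow_mul hM0, mul_one_div_cancel (by positivity),
            Real.rpow_one]
        have h17 : X * M = (4 * (L / M)) ^ ((1:ℝ) / ℓ) * (M ^ ℓ) ^ ((1:ℝ) / ℓ) := by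
          rw [← h14]
        rw [h17, ← Real.mul_rpow (by positivity) (by positivity)]
        congr 1
        obtain ⟨l, rfl⟩ : ∃ l, ℓ = l + 1 := ⟨ℓ - 1, by omega⟩
        have : M ≠ 0 := by linarith
        rw [Nat.add_sub_cancel, pow_succ]
        field_simp
      rw [h13, Real.mul_rpow (by norm_num) (by positivity)]
      gcongr
      calc (4:ℝ) ^ ((1:ℝ)/ℓ) ≤ 4 ^ (1:ℝ) :=
            Real.rpow_le_rpow_of_exponent_le (by norm_num)
              (by rw [div_le_one (by positivity)]; linarith)
        _ = 4 := by norm_num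
    have hsum : (s:ℝ) ≤ ℓ * Real.exp (2 * B * (4 * P + 1) * (X * M)) := by
      rw [hs]
      push_cast
      refine (Finset.sum_le_sum fun k _ => hterm k).trans ?_
      simp
    have hl : (ℓ:ℝ) ≤ Real.exp (ℓ * (X * M)) := by
      have h15 := Real.add_one_le_exp (ℓ * (X * M))
      have h16 : 1 ≤ X * M := by nlinarith
      nlinarith
    calc (s:ℝ) ≤ ℓ * Real.exp (2 * B * (4 * P + 1) * (X * M)) := hsum
      _ ≤ Real.exp (ℓ * (X * M)) * Real.exp (2 * B * (4 * P + 1) * (X * M)) := by gcongr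
      _ = Real.exp ((ℓ + 2 * B * (4 * P + 1)) * (X * M)) := by rw [← Real.exp_add]; ring_nf
      _ ≤ Real.exp ((ℓ + 2 * B * (4 * P + 1)) * (4 * (L * M ^ (ℓ - 1)) ^ ((1:ℝ) / ℓ))) := by
          gcongr
      _ = _ := by ring_nf
end
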